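/- arXiv:1412.0609 — 2 statements merged into one kernel-verified Lean document; each statement's English description precedes it below -/
import Mathlib

section
/- Let f and g be continuous, positive, non-increasing functions on [0,∞), let r ∈ ℕ, n ∈ ℤ₊, and assume φ_{r,0,f}(∞) < ∞. Then for every k = 1, …, r−1 the limit lim_{a→∞} |G_{r,n,f,a}^{(k)}(0)| exists and ω(D^k, φ_{r,n,f}(∞)) = lim_{a→∞} |G_{r,n,f,a}^{(k)}(0)|. -/
open Set Filter MeasureTheory
open scoped Topology

noncomputable section

/-- Weighted sup-norm `‖x‖_{C(S),w} = sup_{t ∈ S} |x t| / w t`. -/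
def wNorm (x w : ℝ → ℝ) (S : Set ℝ) : ℝ :=
  sSup ((fun t => |x t| / w t) '' S)

/-- Sup-norm `‖x‖_{C(S)} = sup_{t ∈ S} |x t|`. -/
def supNorm (x : ℝ → ℝ) (S : Set ℝ) : ℝ :=
  sSup ((fun t => |x t|) '' S)

/-- `G` is a perfect `g`-spline of order `r` on `[0,a]` with exactly `m` knots
`u 1 < ⋯ < u m` (where `u 0 = 0` and `u (m+1) = a`) and sign `ε ∈ {1,-1}`:
`G ∈ C^{r-1}[0,a]`, and on each open interval between consecutive knots `G` is
`r` times differentiable with `G^{(r)}(t) = ε·(-1)^i·g(t)` there. -/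
def PerfectSplineWith (g : ℝ → ℝ) (r : ℕ) (a : ℝ) (m : ℕ) (u : ℕ → ℝ) (ε : ℝ)
    (G : ℝ → ℝ) : Prop :=
  (ε = 1 ∨ ε = -1) ∧ u 0 = 0 ∧ u (m + 1) = a ∧ (∀ i ≤ m, u i < u (i + 1)) ∧
  ContDiffOn ℝ (r - 1 : ℕ) G (Icc 0 a) ∧
  ∀ i ≤ m, ContDiffOn ℝ (r : ℕ) G (Ioo (u i) (u (i + 1))) ∧
    ∀ s ∈ Ioo (u i) (u (i + 1)),
      iteratedDerivWithin r G (Ioo (u i) (u (i + 1))) s = ε * (-1 : ℝ) ^ i * g s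

/-- `Γ^r_{n,g}[0,a]`: perfect `g`-splines of order `r` on `[0,a]` with at most `n` knots. -/
def InGamma (g : ℝ → ℝ) (r n : ℕ) (a : ℝ) (G : ℝ → ℝ) : Prop :=
  ∃ m ≤ n, ∃ u : ℕ → ℝ, ∃ ε : ℝ, PerfectSplineWith g r a m u ε G

/-- `b 1 < ⋯ < b (n+r+1)` are `n+r+1` oscillation points of `G` on `[0,a]`
with respect to the weight `f`, as in (5). -/
def OscPointsAt (f : ℝ → ℝ) (r n : ℕ) (a : ℝ) (G : ℝ → ℝ) (b : ℕ → ℝ) : Prop :=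
  0 ≤ b 1 ∧ b (n + r + 1) = a ∧ (∀ i, 1 ≤ i → i < n + r + 1 → b i < b (i + 1)) ∧
  ∀ i, 1 ≤ i → i ≤ n + r + 1 →
    G (b i) = (-1 : ℝ) ^ (i + r + 1) * (wNorm G f (Icc 0 a) * f (b i))

/-- `G` has `n+r+1` oscillation points on `[0,a]`. -/
def HasOsc (f : ℝ → ℝ) (r n : ℕ) (a : ℝ) (G : ℝ → ℝ) : Prop :=
  ∃ b : ℕ → ℝ, OscPointsAt f r n a G b

/-- `G` is the extremal spline `G_{r,n,f,a}`: a member of `Γ^r_{n,g}[0,a]`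
with `n+r+1` oscillation points. -/
def IsExtremalSpline (f g : ℝ → ℝ) (r n : ℕ) (a : ℝ) (G : ℝ → ℝ) : Prop :=
  InGamma g r n a G ∧ HasOsc f r n a G

/-- Iterated antiderivatives: `g_0 = g`, `g_{k+1}(t) = ∫_0^t g_k`. -/
def gk (g : ℝ → ℝ) : ℕ → ℝ → ℝ
  | 0 => g
  | k + 1 => fun t => ∫ s in (0:ℝ)..t, gk g k s

/-- The constants `A_k` of the paper:
`A_0 = ∫_0^∞ g`, and
`A_k = ∫_0^∞ [ Σ_{s=0}^{k-1} (-1)^{k-s-1} A_s t^{k-s-1}/(k-s-1)! + (-1)^k g_k(t) ] dt`. -/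
def Acoef (g : ℝ → ℝ) : ℕ → ℝ
  | 0 => ∫ t in Ioi (0 : ℝ), g t
  | k + 1 => ∫ t in Ioi (0 : ℝ),
      ((∑ s : Fin (k + 1), (-1 : ℝ) ^ (k - s.1) * Acoef g s.1 * t ^ (k - s.1) /
        (Nat.factorial (k - s.1) : ℝ)) + (-1 : ℝ) ^ (k + 1) * gk g (k + 1) t)

/-- `P_k(t) = Σ_{s=0}^{k-1} (-1)^{k-s-1} A_s t^{k-s-1}/(k-s-1)! + (-1)^k g_k(t)`. -/
def Pfun (g : ℝ → ℝ) (k : ℕ) (t : ℝ) : ℝ :=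
  (∑ s : Fin k, (-1 : ℝ) ^ (k - 1 - s.1) * Acoef g s.1 * t ^ (k - 1 - s.1) /
    (Nat.factorial (k - 1 - s.1) : ℝ)) + (-1 : ℝ) ^ k * gk g k t

/-- Conditions (6): `A_0 < ∞` and `A_k < ∞` for `k = 1, …, r-1`,
expressed as integrability of the corresponding integrands over `(0,∞)`. -/
def Cond6 (g : ℝ → ℝ) (r : ℕ) : Prop :=
  IntegrableOn g (Ioi 0) ∧ ∀ k, 1 ≤ k → k ≤ r - 1 → IntegrableOn (Pfun g k) (Ioi 0)

/-- Membership in the class `W^r_{f,g}(ℝ₊)`: `x ∈ C[0,∞)` with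
`‖x‖_{C[0,∞),f} < ∞`, `x ∈ C^{r-1}[0,∞)`, `x^{(r-1)}` locally absolutely
continuous with `|x^{(r)}| ≤ g` a.e., the latter encoded by the increment bound
`|x^{(r-1)}(t) - x^{(r-1)}(s)| ≤ ∫_s^t g`. -/
def MemW (f g : ℝ → ℝ) (r : ℕ) (x : ℝ → ℝ) : Prop :=
  ContinuousOn x (Ici 0) ∧
  ContDiffOn ℝ (r - 1 : ℕ) x (Ici 0) ∧
  BddAbove ((fun t => |x t| / f t) '' Ici 0) ∧
  ∀ s t : ℝ, 0 ≤ s → s ≤ t →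
    |iteratedDerivWithin (r - 1) x (Ici 0) t - iteratedDerivWithin (r - 1) x (Ici 0) s| ≤
      ∫ u in s..t, g u

/-- The modulus of continuity `ω(D^k, δ)` of the `k`-th differentiation operator on
`W^r_{f,g}(ℝ₊)`. -/
def omegaD (f g : ℝ → ℝ) (r k : ℕ) (δ : ℝ) : ℝ :=
  sSup {y | ∃ x : ℝ → ℝ, MemW f g r x ∧ wNorm x f (Ici 0) ≤ δ ∧
    y = supNorm (iteratedDerivWithin k x (Ici 0)) (Ici 0)}

/-- A perfect `g`-spline of order `r` on `[0,∞)` with exactly `n` knots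
`u 1 < ⋯ < u n` (and `u 0 = 0`), sign `ε`. -/
def PerfectSplineInf (g : ℝ → ℝ) (r n : ℕ) (u : ℕ → ℝ) (ε : ℝ) (Q : ℝ → ℝ) : Prop :=
  (ε = 1 ∨ ε = -1) ∧ u 0 = 0 ∧ (∀ i < n, u i < u (i + 1)) ∧
  ContDiffOn ℝ (r - 1 : ℕ) Q (Ici 0) ∧
  (∀ i < n, ContDiffOn ℝ (r : ℕ) Q (Ioo (u i) (u (i + 1))) ∧
    ∀ s ∈ Ioo (u i) (u (i + 1)),
      iteratedDerivWithin r Q (Ioo (u i) (u (i + 1))) s = ε * (-1 : ℝ) ^ i * g s) ∧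
  ContDiffOn ℝ (r : ℕ) Q (Ioi (u n)) ∧
  ∀ s ∈ Ioi (u n), iteratedDerivWithin r Q (Ioi (u n)) s = ε * (-1 : ℝ) ^ n * g s

end


section Helpers

/-- chain of successive derivatives -/
def Chain13 (p : ℕ) (S : Set ℝ) (F : ℕ → ℝ → ℝ) : Prop :=
  ∀ j < p, ∀ s ∈ S, HasDerivWithinAt (F j) (F (j + 1) s) S s

/-- at least `N` zeros in the closed interval -/
def ZC13 (a : ℝ) (F : ℝ → ℝ) (N : ℕ) : Prop :=
  ∃ z : ℕ → ℝ, (∀ i < N, 0 ≤ z i ∧ z i ≤ a ∧ F (z i) = 0) ∧ ∀ i, i + 1 < N → z i < z (i + 1)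

/-- at least `N` zeros in the open interval -/
def ZO13 (a : ℝ) (F : ℝ → ℝ) (N : ℕ) : Prop :=
  ∃ z : ℕ → ℝ, (∀ i < N, 0 < z i ∧ z i < a ∧ F (z i) = 0) ∧ ∀ i, i + 1 < N → z i < z (i + 1)

lemma ZO13.toC {a : ℝ} {F : ℝ → ℝ} {N : ℕ} (h : ZO13 a F N) : ZC13 a F N := by
  obtain ⟨z, h1, h2⟩ := h
  exact ⟨z, fun i hi => ⟨(h1 i hi).1.le, (h1 i hi).2.1.le, (h1 i hi).2.2⟩, h2⟩

lemma ZO13.cons {a : ℝ} (ha : 0 ≤ a) {F : ℝ → ℝ} {N : ℕ} (h : ZO13 a F N) (h0 : F 0 = 0) :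
    ZC13 a F (N + 1) := by
  obtain ⟨z, h1, h2⟩ := h
  refine ⟨fun i => if i = 0 then 0 else z (i - 1), ?_, ?_⟩
  · intro i hi
    rcases i with _ | i
    · simp [h0, ha]
    · have := h1 i (by omega)
      simp only [Nat.add_eq_zero_iff, one_ne_zero, and_false, if_false, Nat.add_sub_cancel]
      exact ⟨this.1.le, this.2.1.le, this.2.2⟩
  · intro i hi
    rcases i with _ | i
    · simpa using (h1 0 (by omega)).1
    · simpa using h2 i (by omega)

lemma rolle13 {a : ℝ} {F F' : ℝ → ℝ}
    (hd : ∀ s ∈ Icc 0 a, HasDerivWithinAt F (F' s) (Icc 0 a) s) {N : ℕ}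
    (h : ZC13 a F (N + 1)) : ZO13 a F' N := by
  obtain ⟨z, h1, h2⟩ := h
  have key : ∀ i, ∃ w, i < N → z i < w ∧ w < z (i + 1) ∧ F' w = 0 := by
    intro i
    by_cases hi : i < N
    · have a1 := h1 i (by omega)
      have a2 := h1 (i + 1) (by omega)
      obtain ⟨c, hc, hc0⟩ := exists_hasDerivAt_eq_zero (f := F) (f' := F')
        (h2 i (by omega))
        (fun s hs => ((hd s ⟨a1.1.trans hs.1, hs.2.trans a2.2.1⟩).continuousWithinAt).mono
          (Icc_subset_Icc a1.1 a2.2.1)) (by rw [a1.2.2, a2.2.2])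
        (fun s hs => (hd s ⟨a1.1.trans hs.1.le, hs.2.le.trans a2.2.1⟩).hasDerivAt
          (Icc_mem_nhds (a1.1.trans_lt hs.1) (hs.2.trans_le a2.2.1)))
      exact ⟨c, fun _ => ⟨hc.1, hc.2, hc0⟩⟩
    · exact ⟨0, fun h => absurd h hi⟩
  choose w hw using key
  refine ⟨w, fun i hi => ?_, fun i hi => ?_⟩
  · have := hw i hi
    exact ⟨(h1 i (by omega)).1.trans_lt this.1, this.2.1.trans_le (h1 (i + 1) (by omega)).2.1,
      this.2.2⟩
  · exact (hw i (by omega)).2.1.trans (hw (i + 1) hi).1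

lemma rolle_iter13 {a : ℝ} {p : ℕ} {F : ℕ → ℝ → ℝ} (hc : Chain13 p (Icc 0 a) F) (j d N : ℕ)
    (hj : j + d ≤ p) (h : ZC13 a (F j) (N + d)) : ZC13 a (F (j + d)) N := by
  induction d generalizing N with
  | zero => simpa using h
  | succ d ih =>
    have := ih (N + 1) (by omega) (by rwa [show N + 1 + d = N + (d + 1) by omega])
    exact (rolle13 (hc (j + d) (by omega)) this).toC

lemma rolle_iterO13 {a : ℝ} {p : ℕ} {F : ℕ → ℝ → ℝ} (hc : Chain13 p (Icc 0 a) F) (j d N : ℕ)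
    (hj : j + d ≤ p) (h : ZO13 a (F j) (N + d)) : ZO13 a (F (j + d)) N := by
  induction d generalizing N with
  | zero => simpa using h
  | succ d ih =>
    have := ih (N + 1) (by omega) (by rwa [show N + 1 + d = N + (d + 1) by omega])
    exact (rolle13 (hc (j + d) (by omega)) this.toC)

lemma piece13 {a : ℝ} {m : ℕ} {u : ℕ → ℝ} (h0 : u 0 = 0) (ha : u (m + 1) = a)
    {z : ℝ} (hz0 : 0 ≤ z) (hza : z ≤ a) : ∃ i ≤ m, z ∈ Icc (u i) (u (i + 1)) := by
  by_contra hcon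
  push Not at hcon
  have : ∀ i, i ≤ m + 1 → u i ≤ z ∧ (0 < i → u i < z) := by
    intro i
    induction i with
    | zero => intro _; exact ⟨by rw [h0]; exact hz0, by simp⟩
    | succ i ih =>
      intro hi
      have h1 := ih (by omega)
      have h2 := hcon i (by omega)
      have : u (i + 1) < z := by
        by_contra h3
        exact h2 ⟨h1.1, not_lt.1 h3⟩
      exact ⟨this.le, fun _ => this⟩
  have := (this (m + 1) le_rfl).2 (by omega)
  linarith

lemma u_bounds13 {a : ℝ} {m : ℕ} {u : ℕ → ℝ} (h0 : u 0 = 0) (ha : u (m + 1) = a)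
    (hu : ∀ i ≤ m, u i < u (i + 1)) : ∀ i ≤ m + 1, 0 ≤ u i ∧ u i ≤ a := by
  have A : ∀ i ≤ m + 1, 0 ≤ u i := by
    intro i
    induction i with
    | zero => intro _; rw [h0]
    | succ i ih => intro hi; exact (ih (by omega)).trans (hu i (by omega)).le
  have B : ∀ d, d ≤ m + 1 → u (m + 1 - d) ≤ a := by
    intro d
    induction d with
    | zero => intro _; simp [ha]
    | succ d ih =>
      intro hd
      have := hu (m + 1 - (d + 1)) (by omega)
      rw [show m + 1 - (d + 1) + 1 = m + 1 - d by omega] at this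
      exact this.le.trans (ih (by omega))
  intro i hi
  refine ⟨A i hi, ?_⟩
  have := B (m + 1 - i) (by omega)
  rwa [show m + 1 - (m + 1 - i) = i by omega] at this

lemma zc_strict13 {z : ℕ → ℝ} {N : ℕ} (h : ∀ i, i + 1 < N → z i < z (i + 1)) :
    ∀ i j, i < j → j < N → z i < z j := by
  intro i j hij
  induction j, hij using Nat.le_induction with
  | base => intro hj; exact h i hj
  | succ j hj ih => intro hN; exact (ih (by omega)).trans (h j hN)

lemma count13 {a : ℝ} {m N : ℕ} {u : ℕ → ℝ} (h0 : u 0 = 0) (ha : u (m + 1) = a) {F : ℝ → ℝ}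
    (hinj : ∀ i ≤ m, ∀ s t, u i ≤ s → s < t → t ≤ u (i + 1) → F s ≠ F t) (hN : m + 1 < N)
    (hz : ZC13 a F N) : False := by
  obtain ⟨z, h1, h2⟩ := hz
  have key : ∀ i, ∃ l, i < N → l ≤ m ∧ z i ∈ Icc (u l) (u (l + 1)) := by
    intro i
    by_cases hi : i < N
    · obtain ⟨l, hl, hl2⟩ := piece13 h0 ha (h1 i hi).1 (h1 i hi).2.1
      exact ⟨l, fun _ => ⟨hl, hl2⟩⟩
    · exact ⟨0, fun h => absurd h hi⟩
  choose q hq using key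
  obtain ⟨x, hx, y, hy, hxy, he⟩ := Finset.exists_ne_map_eq_of_card_lt_of_maps_to
    (s := Finset.range N) (t := Finset.range (m + 1)) (by simpa using hN) (f := q)
    (fun i hi => by
      have := hq i (by simpa using hi)
      simp; omega)
  simp only [Finset.mem_range] at hx hy
  have main : ∀ x y, x < y → y < N → q x = q y → False := by
    intro x y hlt hy he
    have e1 := hq x (by omega)
    have e2 := hq y hy
    rw [← he] at e2
    refine hinj (q x) e1.1 (z x) (z y) e1.2.1 (zc_strict13 h2 x y hlt hy) e2.2.2 ?_
    rw [(h1 x (by omega)).2.2, (h1 y hy).2.2]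
  rcases lt_or_gt_of_ne hxy with h | h
  · exact main x y h hy he
  · exact main y x h hx he.symm

lemma chain_sub13 {p : ℕ} {S : Set ℝ} {F X : ℕ → ℝ → ℝ} (hF : Chain13 p S F) (hX : Chain13 p S X)
    (c : ℝ) : Chain13 p S (fun j t => F j t - c * X j t) := fun j hj s hs =>
  (hF j hj s hs).sub ((hX j hj s hs).const_mul c)

lemma compare13 {f g : ℝ → ℝ} {p n m k : ℕ} {a φ : ℝ} {u b : ℕ → ℝ} {G X : ℕ → ℝ → ℝ}
    (hp : 1 ≤ p) (hk : k ≤ p) (hmn : m ≤ n) (ha0 : 0 < a) (hφ : 0 < φ)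
    (hf : ∀ t, 0 ≤ t → 0 < f t)
    (hG : Chain13 p (Icc 0 a) G) (hX : Chain13 p (Icc 0 a) X)
    (h0 : u 0 = 0) (ha : u (m + 1) = a) (hu : ∀ i ≤ m, u i < u (i + 1))
    (hg : ∀ s t, 0 ≤ s → s < t → 0 < ∫ x in s..t, g x)
    (hinc : ∀ i ≤ m, ∀ s t, u i ≤ s → s < t → t ≤ u (i + 1) →
      |G p t - G p s| = ∫ x in s..t, g x)
    (hXinc : ∀ s t, 0 ≤ s → s ≤ t → t ≤ a → |X p t - X p s| ≤ ∫ x in s..t, g x)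
    (hXf : ∀ t, 0 ≤ t → t ≤ a → |X 0 t| ≤ φ * f t)
    (hb1 : 0 ≤ b 1) (hba : b (n + (p + 1) + 1) = a)
    (hb : ∀ i, 1 ≤ i → i < n + (p + 1) + 1 → b i < b (i + 1))
    (hosc : ∀ i, 1 ≤ i → i ≤ n + (p + 1) + 1 →
      G 0 (b i) = (-1 : ℝ) ^ (i + (p + 1) + 1) * (φ * f (b i))) :
    |X k 0| ≤ |G k 0| := by
  by_contra hcon
  push Not at hcon
  have hXk : X k 0 ≠ 0 := by
    intro h; rw [h, abs_zero] at hcon; exact absurd hcon (not_lt.2 (abs_nonneg _))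
  set l := G k 0 / X k 0 with hl
  have hl1 : |l| < 1 := by
    rw [hl, abs_div, div_lt_one (abs_pos.2 hXk)]; exact hcon
  set F : ℕ → ℝ → ℝ := fun j t => G j t - l * X j t with hFdef
  have hF : Chain13 p (Icc 0 a) F := chain_sub13 hG hX l
  have hub := u_bounds13 h0 ha hu
  have hFk : F k 0 = 0 := by
    simp only [hFdef, hl]; field_simp; ring
  -- bounds for b
  have hbl : ∀ i, 1 ≤ i → i ≤ n + (p + 1) + 1 → 0 ≤ b i := by
    intro i hi
    induction i, hi using Nat.le_induction with
    | base => intro _; exact hb1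
    | succ i hi ih => intro h; exact (ih (by omega)).trans (hb i hi (by omega)).le
  have hbr : ∀ d, d < n + (p + 1) + 1 → b (n + (p + 1) + 1 - d) ≤ a := by
    intro d
    induction d with
    | zero => intro _; simp [hba]
    | succ d ih =>
      intro hd
      have := hb (n + (p + 1) + 1 - (d + 1)) (by omega) (by omega)
      rw [show n + (p + 1) + 1 - (d + 1) + 1 = n + (p + 1) + 1 - d by omega] at this
      exact this.le.trans (ih (by omega))
  have hbr' : ∀ i, 1 ≤ i → i ≤ n + (p + 1) + 1 → b i ≤ a := by
    intro i h1 h2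
    have := hbr (n + (p + 1) + 1 - i) (by omega)
    rwa [show n + (p + 1) + 1 - (n + (p + 1) + 1 - i) = i by omega] at this
  have hFc : ContinuousOn (F 0) (Icc 0 a) := fun s hs => (hF 0 (by omega) s hs).continuousWithinAt
  have hsgn : ∀ i, 1 ≤ i → i ≤ n + (p + 1) + 1 →
      0 < (-1 : ℝ) ^ (i + (p + 1) + 1) * F 0 (b i) := by
    intro i h1 h2
    have hfb := hf _ (hbl i h1 h2)
    have hx := hXf _ (hbl i h1 h2) (hbr' i h1 h2)
    have hpos : 0 < φ * f (b i) := mul_pos hφ hfb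
    have : |l * X 0 (b i)| < φ * f (b i) := by
      rw [abs_mul]
      calc |l| * |X 0 (b i)| ≤ |l| * (φ * f (b i)) := by gcongr
        _ < 1 * (φ * f (b i)) := by gcongr
        _ = _ := one_mul _
    simp only [hFdef, hosc i h1 h2]
    rw [abs_lt] at this
    rcases neg_one_pow_eq_or ℝ (i + (p + 1) + 1) with h | h <;> rw [h] <;> linarith
  have hz : ∀ i, ∃ z, i < n + (p + 1) → b (i + 1) < z ∧ z < b (i + 2) ∧ F 0 z = 0 := by
    intro i
    by_cases hi : i < n + (p + 1)
    · have s1 := hsgn (i + 1) (by omega) (by omega)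
      have s2 := hsgn (i + 2) (by omega) (by omega)
      have hlt := hb (i + 1) (by omega) (by omega)
      have hcc : ContinuousOn (F 0) (Icc (b (i + 1)) (b (i + 2))) := hFc.mono
        (Icc_subset_Icc (hbl _ (by omega) (by omega)) (hbr' _ (by omega) (by omega)))
      rw [show i + 2 + (p + 1) + 1 = (i + 1 + (p + 1) + 1) + 1 by omega, pow_succ] at s2
      rcases neg_one_pow_eq_or ℝ (i + 1 + (p + 1) + 1) with h | h
      · rw [h] at s1 s2
        obtain ⟨z, hz1, hz2⟩ := intermediate_value_Ioo' hlt.le hcc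
          (show (0 : ℝ) ∈ Ioo _ _ from ⟨by linarith, by linarith⟩)
        exact ⟨z, fun _ => ⟨hz1.1, hz1.2, hz2⟩⟩
      · rw [h] at s1 s2
        obtain ⟨z, hz1, hz2⟩ := intermediate_value_Ioo hlt.le hcc
          (show (0 : ℝ) ∈ Ioo _ _ from ⟨by linarith, by linarith⟩)
        exact ⟨z, fun _ => ⟨hz1.1, hz1.2, hz2⟩⟩
    · exact ⟨0, fun h => absurd h hi⟩
  choose z hz using hz
  have hZ0 : ZO13 a (F 0) (n + (p + 1)) := by
    refine ⟨z, fun i hi => ⟨?_, ?_, (hz i hi).2.2⟩, fun i hi => ?_⟩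
    · exact (hbl (i + 1) (by omega) (by omega)).trans_lt (hz i hi).1
    · exact (hz i hi).2.1.trans_le (hbr' (i + 2) (by omega) (by omega))
    · exact (hz i (by omega)).2.1.trans (hz (i + 1) hi).1
  have hZk : ZO13 a (F (0 + k)) (n + (p + 1) - k) :=
    rolle_iterO13 hF 0 k _ (by omega) (by rwa [show n + (p + 1) - k + k = n + (p + 1) by omega])
  rw [zero_add] at hZk
  have hZk' := hZk.cons ha0.le hFk
  have hZp := rolle_iter13 hF k (p - k) (n + 2) (by omega)
    (by rwa [show n + 2 + (p - k) = n + (p + 1) - k + 1 by omega])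
  rw [show k + (p - k) = p by omega] at hZp
  refine count13 (m := m) h0 ha ?_ (by omega) hZp
  intro i hi s t hs hst ht he
  have e1 := hinc i hi s t hs hst ht
  have hs0 : 0 ≤ s := (hub i (by omega)).1.trans hs
  have e2 := hXinc s t hs0 hst.le (ht.trans (hub (i + 1) (by omega)).2)
  have e3 := hg s t hs0 hst
  simp only [hFdef] at he
  have : G p t - G p s = l * (X p t - X p s) := by linarith
  rw [this, abs_mul] at e1
  have : |l| * |X p t - X p s| ≤ |l| * ∫ x in s..t, g x := by gcongr
  have : |l| * ∫ x in s..t, g x < 1 * ∫ x in s..t, g x := by gcongr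
  linarith

lemma xi13 (M : ℝ) (j : ℕ) : ∀ ℓ : ℝ, 0 < ℓ → ∃ C : ℝ, ∀ (F : ℕ → ℝ → ℝ) (a c : ℝ), 0 ≤ c →
    c + ℓ ≤ a → Chain13 j (Icc 0 a) F → (∀ t ∈ Icc 0 a, |F 0 t| ≤ M) →
    ∃ ξ ∈ Icc c (c + ℓ), |F j ξ| ≤ C := by
  induction j with
  | zero =>
    intro ℓ hℓ
    exact ⟨M, fun F a c hc hca _ hM => ⟨c, ⟨le_rfl, by linarith⟩, hM c ⟨hc, by linarith⟩⟩⟩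
  | succ j ih =>
    intro ℓ hℓ
    obtain ⟨C, hC⟩ := ih (ℓ / 3) (by linarith)
    refine ⟨2 * C / (ℓ / 3), fun F a c hc hca hF hM => ?_⟩
    have hF' : Chain13 j (Icc 0 a) F := fun i hi => hF i (by omega)
    obtain ⟨x, hx, hx2⟩ := hC F a c hc (by linarith) hF' hM
    obtain ⟨y, hy, hy2⟩ := hC F a (c + 2 * ℓ / 3) (by linarith) (by linarith) hF' hM
    have hxy : ℓ / 3 ≤ y - x := by linarith [hx.2, hy.1]
    obtain ⟨ξ, hξ, he⟩ := exists_hasDerivAt_eq_slope (F j) (F (j + 1)) (a := x) (b := y)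
      (by linarith)
      (fun s hs => ((hF j (by omega) s ⟨by linarith [hx.1, hs.1], by linarith [hs.2, hy.2]⟩).continuousWithinAt).mono
          (Icc_subset_Icc (by linarith [hx.1]) (by linarith [hy.2])))
      (fun s hs => (hF j (by omega) s ⟨by linarith [hx.1, hs.1], by linarith [hs.2, hy.2]⟩).hasDerivAt
          (Icc_mem_nhds (by linarith [hx.1, hs.1]) (by linarith [hs.2, hy.2])))
    refine ⟨ξ, ⟨by linarith [hx.1, hξ.1], by linarith [hξ.2, hy.2]⟩, ?_⟩
    rw [he, abs_div, abs_of_pos (show 0 < y - x by linarith)]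
    have : |F j y - F j x| ≤ 2 * C := by
      calc _ ≤ |F j y| + |F j x| := abs_sub _ _
        _ ≤ _ := by linarith
    have h0 : 0 ≤ 2 * C := (abs_nonneg _).trans this
    gcongr

lemma bound13 (M K0 : ℝ) (p d : ℕ) (hd : d ≤ p) : ∃ K : ℝ, ∀ (F : ℕ → ℝ → ℝ) (a : ℝ), 1 ≤ a →
    Chain13 p (Icc 0 a) F → (∀ t ∈ Icc 0 a, |F 0 t| ≤ M) →
    (∀ s ∈ Icc 0 a, ∀ t ∈ Icc 0 a, |F p t - F p s| ≤ K0 * |t - s|) →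
    (∀ t ∈ Icc 0 a, |F (p - d) t| ≤ K) ∧
    (∀ s ∈ Icc 0 a, ∀ t ∈ Icc 0 a, |F (p - d) t - F (p - d) s| ≤ K * |t - s|) := by
  induction d with
  | zero =>
    obtain ⟨C, hC⟩ := xi13 M p 1 one_pos
    refine ⟨max (C + |K0|) |K0|, fun F a ha hF hM hK => ⟨fun t ht => ?_, fun s hs t ht => ?_⟩⟩
    · obtain ⟨ξ, hξ, h2⟩ := hC F a (min t (a - 1)) (le_min ht.1 (by linarith))
        (by linarith [min_le_right t (a - 1)]) hF hM
      have hξ' : ξ ∈ Icc 0 a := ⟨(le_min ht.1 (by linarith)).trans hξ.1,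
        hξ.2.trans (by linarith [min_le_right t (a - 1)])⟩
      have h3 : |t - ξ| ≤ 1 := by
        rw [abs_le]
        rcases min_cases t (a - 1) with h | h
        · exact ⟨by linarith [hξ.2], by linarith [hξ.1]⟩
        · exact ⟨by linarith [hξ.2], by linarith [hξ.1, ht.2]⟩
      have h4 := hK ξ hξ' t ht
      have h5 : K0 * |t - ξ| ≤ |K0| := by
        calc _ ≤ |K0| * |t - ξ| := by gcongr; exact le_abs_self _
          _ ≤ |K0| * 1 := by gcongr
          _ = _ := mul_one _
      refine le_trans ?_ (le_max_left _ _)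
      calc |F (p - 0) t| = |F p ξ + (F p t - F p ξ)| := by simp
        _ ≤ _ := abs_add_le _ _
        _ ≤ _ := by linarith
    · refine (hK s hs t ht).trans ?_
      gcongr
      exact (le_abs_self _).trans (le_max_right _ _)
  | succ d ih =>
    obtain ⟨K, hK⟩ := ih (by omega)
    obtain ⟨C, hC⟩ := xi13 M (p - (d + 1)) 1 one_pos
    refine ⟨max (C + |K|) |K|, fun F a ha hF hM hK0 => ?_⟩
    have hch : Chain13 (p - (d + 1)) (Icc 0 a) F := fun i hi => hF i (by omega)
    have hlip : ∀ s ∈ Icc 0 a, ∀ t ∈ Icc 0 a,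
        |F (p - (d + 1)) t - F (p - (d + 1)) s| ≤ |K| * |t - s| := by
      intro s hs t ht
      have hb := (hK F a ha hF hM hK0).1
      have := (convex_Icc (0 : ℝ) a).norm_image_sub_le_of_norm_hasDerivWithin_le
        (f := F (p - (d + 1))) (f' := F (p - (d + 1) + 1)) (C := |K|)
        (fun x hx => hF (p - (d + 1)) (by omega) x hx)
        (fun x hx => by
          rw [show p - (d + 1) + 1 = p - d by omega]
          exact (hb x hx).trans (le_abs_self _)) hs ht
      simpa [Real.norm_eq_abs] using this
    refine ⟨fun t ht => ?_, fun s hs t ht => ?_⟩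
    · obtain ⟨ξ, hξ, h2⟩ := hC F a (min t (a - 1)) (le_min ht.1 (by linarith))
        (by linarith [min_le_right t (a - 1)]) hch hM
      have hξ' : ξ ∈ Icc 0 a := ⟨(le_min ht.1 (by linarith)).trans hξ.1,
        hξ.2.trans (by linarith [min_le_right t (a - 1)])⟩
      have h3 : |t - ξ| ≤ 1 := by
        rw [abs_le]
        rcases min_cases t (a - 1) with h | h
        · exact ⟨by linarith [hξ.2], by linarith [hξ.1]⟩
        · exact ⟨by linarith [hξ.2], by linarith [hξ.1, ht.2]⟩
      have h4 := hlip ξ hξ' t ht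
      have h5 : |K| * |t - ξ| ≤ |K| := by
        calc _ ≤ |K| * 1 := by gcongr
          _ = _ := mul_one _
      refine le_trans ?_ (le_max_left _ _)
      calc |F (p - (d + 1)) t|
          = |F (p - (d + 1)) ξ + (F (p - (d + 1)) t - F (p - (d + 1)) ξ)| := by simp
        _ ≤ _ := abs_add_le _ _
        _ ≤ _ := by linarith
    · refine (hlip s hs t ht).trans ?_
      gcongr
      exact le_max_right _ _

lemma bound_all13 (M K0 : ℝ) (p : ℕ) : ∃ K : ℝ, ∀ (F : ℕ → ℝ → ℝ) (a : ℝ), 1 ≤ a →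
    Chain13 p (Icc 0 a) F → (∀ t ∈ Icc 0 a, |F 0 t| ≤ M) →
    (∀ s ∈ Icc 0 a, ∀ t ∈ Icc 0 a, |F p t - F p s| ≤ K0 * |t - s|) → ∀ j ≤ p,
    (∀ t ∈ Icc 0 a, |F j t| ≤ K) ∧
    (∀ s ∈ Icc 0 a, ∀ t ∈ Icc 0 a, |F j t - F j s| ≤ K * |t - s|) := by
  have h : ∀ d, ∃ K : ℝ, d ≤ p → ∀ (F : ℕ → ℝ → ℝ) (a : ℝ), 1 ≤ a →
      Chain13 p (Icc 0 a) F → (∀ t ∈ Icc 0 a, |F 0 t| ≤ M) →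
      (∀ s ∈ Icc 0 a, ∀ t ∈ Icc 0 a, |F p t - F p s| ≤ K0 * |t - s|) →
      (∀ t ∈ Icc 0 a, |F (p - d) t| ≤ K) ∧
      (∀ s ∈ Icc 0 a, ∀ t ∈ Icc 0 a, |F (p - d) t - F (p - d) s| ≤ K * |t - s|) := by
    intro d
    by_cases hd : d ≤ p
    · obtain ⟨K, hK⟩ := bound13 M K0 p d hd
      exact ⟨K, fun _ => hK⟩
    · exact ⟨0, fun h => absurd h hd⟩
  choose K hK using h
  refine ⟨∑ d ∈ Finset.range (p + 1), |K d|, fun F a ha hF hM hK0 j hj => ?_⟩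
  have h1 := hK (p - j) (by omega) F a ha hF hM hK0
  rw [show p - (p - j) = j by omega] at h1
  have h2 : K (p - j) ≤ ∑ d ∈ Finset.range (p + 1), |K d| :=
    (le_abs_self _).trans (Finset.single_le_sum (f := fun d => |K d|)
      (fun i _ => abs_nonneg _) (by simp))
  refine ⟨fun t ht => (h1.1 t ht).trans h2, fun s hs t ht => (h1.2 s hs t ht).trans ?_⟩
  gcongr

lemma taylor13 {a K : ℝ} {F F' : ℝ → ℝ}
    (hd : ∀ s ∈ Icc 0 a, HasDerivWithinAt F (F' s) (Icc 0 a) s)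
    (hl : ∀ s ∈ Icc 0 a, ∀ t ∈ Icc 0 a, |F' t - F' s| ≤ K * |t - s|)
    {s t : ℝ} (hs : s ∈ Icc 0 a) (ht : t ∈ Icc 0 a) :
    |F t - F s - (t - s) * F' s| ≤ |K| * |t - s| ^ 2 := by
  have hsub : uIcc s t ⊆ Icc 0 a := by
    rw [← uIcc_of_le (hs.1.trans hs.2)] at *
    exact uIcc_subset_uIcc hs ht
  have hder : ∀ x ∈ uIcc s t, HasDerivWithinAt (fun x => F x - x * F' s) (F' x - 1 * F' s)
      (uIcc s t) x := fun x hx =>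
    ((hd x (hsub hx)).mono hsub).sub ((hasDerivWithinAt_id x _).mul_const _)
  have := (convex_uIcc s t).norm_image_sub_le_of_norm_hasDerivWithin_le (C := |K| * |t - s|) hder
    (fun x hx => by
      rw [one_mul, Real.norm_eq_abs]
      refine (hl s hs x (hsub hx)).trans ?_
      have : |x - s| ≤ |t - s| := abs_sub_left_of_mem_uIcc hx
      calc K * |x - s| ≤ |K| * |x - s| := by gcongr; exact le_abs_self _
        _ ≤ _ := by gcongr) left_mem_uIcc right_mem_uIcc
  rw [Real.norm_eq_abs, Real.norm_eq_abs] at this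
  calc _ = |F t - t * F' s - (F s - s * F' s)| := by congr 1; ring
    _ ≤ _ := this
    _ = _ := by ring

lemma chain_of_contDiffOn13 {p : ℕ} {x : ℝ → ℝ} {S : Set ℝ} (hS : UniqueDiffOn ℝ S)
    (h : ContDiffOn ℝ (p : ℕ) x S) : Chain13 p S (fun j => iteratedDerivWithin j x S) := by
  intro j hj s hs
  have := (h.differentiableOn_iteratedDerivWithin (m := j) (by exact_mod_cast hj) hS) s hs
  have h2 := this.hasDerivWithinAt
  simpa only [iteratedDerivWithin_succ] using h2

lemma chain_eqOn13 {p : ℕ} {S : Set ℝ} (hS : UniqueDiffOn ℝ S) {Z : ℕ → ℝ → ℝ}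
    (hZ : Chain13 p S Z) : ∀ j ≤ p, EqOn (iteratedDerivWithin j (Z 0) S) (Z j) S := by
  intro j
  induction j with
  | zero => intro _ s _; simp
  | succ j ih =>
    intro hj s hs
    rw [iteratedDerivWithin_succ, derivWithin_congr (ih (by omega)) (ih (by omega) hs)]
    exact (hZ j (by omega) s hs).derivWithin (hS s hs)

lemma contDiffOn_of_chain13 {p : ℕ} {S : Set ℝ} (hS : UniqueDiffOn ℝ S) {Z : ℕ → ℝ → ℝ}
    (hZ : Chain13 p S Z) (hc : ContinuousOn (Z p) S) : ContDiffOn ℝ (p : ℕ) (Z 0) S := by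
  have hE := chain_eqOn13 hS hZ
  have hd : ∀ m < p, DifferentiableOn ℝ (Z m) S := fun m hm s hs =>
    (hZ m hm s hs).differentiableWithinAt
  refine contDiffOn_of_continuousOn_differentiableOn_deriv (n := (p : ℕ∞)) (fun m hm => ?_)
    (fun m hm => ?_)
  · have hm' : m ≤ p := by exact_mod_cast hm
    refine ContinuousOn.congr ?_ (hE m hm')
    rcases hm'.lt_or_eq with h | h
    · exact (hd m h).continuousOn
    · rw [h]; exact hc
  · have hm' : m < p := by exact_mod_cast hm
    exact (hd m hm').congr (hE m hm'.le)

lemma int_pos13 {g : ℝ → ℝ} (hg_c : ContinuousOn g (Ici 0)) (hg_pos : ∀ t ∈ Ici (0:ℝ), 0 < g t)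
    {s t : ℝ} (hs : 0 ≤ s) (hst : s < t) : 0 < ∫ x in s..t, g x := by
  have hc : ContinuousOn g (Icc s t) := hg_c.mono (fun x hx => hs.trans hx.1)
  exact intervalIntegral.intervalIntegral_pos_of_pos_on
    (hc.intervalIntegrable_of_Icc hst.le) (fun x hx => hg_pos x (hs.trans hx.1.le)) hst

lemma int_le13 {g : ℝ → ℝ} (hg_c : ContinuousOn g (Ici 0)) (hg_anti : AntitoneOn g (Ici 0))
    {s t c : ℝ} (hs : 0 ≤ s) (hst : s ≤ t) (hc : 0 ≤ c) (hcs : c ≤ s) :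
    ∫ x in s..t, g x ≤ g c * (t - s) := by
  have hc' : ContinuousOn g (Icc s t) := hg_c.mono (fun x hx => hs.trans hx.1)
  have := intervalIntegral.integral_mono_on hst (hc'.intervalIntegrable_of_Icc hst)
    (intervalIntegrable_const (μ := volume) (c := g c))
    (fun x hx => hg_anti hc (hs.trans hx.1) (hcs.trans hx.1))
  simpa [mul_comm] using this

lemma spline_inc13 {g : ℝ → ℝ} (hg_c : ContinuousOn g (Ici 0)) {p m : ℕ} {a ε : ℝ} {u : ℕ → ℝ}
    {G : ℝ → ℝ} (ha0 : 0 < a) (h : PerfectSplineWith g (p + 1) a m u ε G) :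
    ∀ i ≤ m, ∀ s t, u i ≤ s → s < t → t ≤ u (i + 1) →
      iteratedDerivWithin p G (Icc 0 a) t - iteratedDerivWithin p G (Icc 0 a) s =
        ε * (-1 : ℝ) ^ i * ∫ x in s..t, g x := by
  obtain ⟨hε, h0, ha, hu, hC, hD⟩ := h
  have hub := u_bounds13 h0 ha hu
  intro i hi s t hs hst ht
  have hs0 : 0 ≤ s := (hub i (by omega)).1.trans hs
  have hta : t ≤ a := ht.trans (hub (i + 1) (by omega)).2
  obtain ⟨hD1, hD2⟩ := hD i hi
  have hcont : ContinuousOn (iteratedDerivWithin p G (Icc 0 a)) (Icc 0 a) := by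
    refine hC.continuousOn_iteratedDerivWithin ?_ (uniqueDiffOn_Icc ha0)
    simp
  have hder : ∀ x ∈ Ioo s t, HasDerivAt (iteratedDerivWithin p G (Icc 0 a))
      (ε * (-1 : ℝ) ^ i * g x) x := by
    intro x hx
    have hxI : x ∈ Ioo (u i) (u (i + 1)) := ⟨hs.trans_lt hx.1, hx.2.trans_le ht⟩
    have hch := chain_of_contDiffOn13 (isOpen_Ioo.uniqueDiffOn) hD1 p (by omega) x hxI
    beta_reduce at hch
    rw [hD2 x hxI] at hch
    have h1 := hch.hasDerivAt (isOpen_Ioo.mem_nhds hxI)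
    refine h1.congr_of_eventuallyEq ?_
    filter_upwards [isOpen_Ioo.mem_nhds hxI] with y hy
    have hy0 : 0 < y := (hub i (by omega)).1.trans_lt hy.1
    have hya : y < a := hy.2.trans_le (hub (i + 1) (by omega)).2
    have he : Icc 0 a =ᶠ[𝓝 y] Ioo (u i) (u (i + 1)) := by
      have e1 : Icc 0 a =ᶠ[𝓝 y] univ := by
        rw [eventuallyEq_univ]; exact Icc_mem_nhds hy0 hya
      have e2 : Ioo (u i) (u (i + 1)) =ᶠ[𝓝 y] univ := by
        rw [eventuallyEq_univ]; exact isOpen_Ioo.mem_nhds hy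
      exact e1.trans e2.symm
    simp only [iteratedDerivWithin, iteratedFDerivWithin_congr_set he]
  have hgc : ContinuousOn g (Icc s t) := hg_c.mono (fun x hx => hs0.trans hx.1)
  have := intervalIntegral.integral_eq_sub_of_hasDerivAt_of_le hst.le
    (hcont.mono (Icc_subset_Icc hs0 hta)) hder
    ((hgc.intervalIntegrable_of_Icc hst.le).const_mul _)
  rw [← this, intervalIntegral.integral_const_mul]

lemma glue13 {g F : ℝ → ℝ} (hg_c : ContinuousOn g (Ici 0)) {m : ℕ} {a : ℝ} {u : ℕ → ℝ}
    (h0 : u 0 = 0) (ha : u (m + 1) = a) (hu : ∀ i ≤ m, u i < u (i + 1))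
    (hinc : ∀ i ≤ m, ∀ s t, u i ≤ s → s < t → t ≤ u (i + 1) →
      |F t - F s| = ∫ x in s..t, g x) :
    ∀ s t, 0 ≤ s → s ≤ t → t ≤ a → |F t - F s| ≤ ∫ x in s..t, g x := by
  have hub := u_bounds13 h0 ha hu
  have hinc' : ∀ i ≤ m, ∀ s t, u i ≤ s → s ≤ t → t ≤ u (i + 1) →
      |F t - F s| ≤ ∫ x in s..t, g x := by
    intro i hi s t hs hst ht
    rcases hst.eq_or_lt with h | h
    · simp [h]
    · exact (hinc i hi s t hs h ht).le
  have hii : ∀ s t, 0 ≤ s → s ≤ t → IntervalIntegrable g volume s t := fun s t hs hst =>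
    ContinuousOn.intervalIntegrable_of_Icc hst (hg_c.mono (fun x hx => hs.trans hx.1))
  have key : ∀ i ≤ m + 1, ∀ s t, 0 ≤ s → s ≤ t → t ≤ u i → |F t - F s| ≤ ∫ x in s..t, g x := by
    intro i
    induction i with
    | zero =>
      intro _ s t hs hst ht
      rw [h0] at ht
      have : s = t := by linarith
      simp [this]
    | succ i ih =>
      intro hi s t hs hst ht
      have ih := ih (by omega)
      rcases le_total t (u i) with h | h
      · exact ih s t hs hst h
      · rcases le_total s (u i) with h' | h'
        · have e1 := ih s (u i) hs h' le_rfl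
          have e2 := hinc' i (by omega) (u i) t le_rfl h ht
          rw [← intervalIntegral.integral_add_adjacent_intervals (hii s (u i) hs h')
            (hii (u i) t (hs.trans h') h)]
          calc |F t - F s| = |(F (u i) - F s) + (F t - F (u i))| := by congr 1; ring
            _ ≤ _ := abs_add_le _ _
            _ ≤ _ := by linarith
        · exact hinc' i (by omega) s t h' hst ht
  intro s t hs hst ht
  exact key (m + 1) le_rfl s t hs hst (by rw [ha]; exact ht)

lemma wNorm_nonneg13 {x f : ℝ → ℝ} {S : Set ℝ} (hf : ∀ t ∈ S, 0 < f t) : 0 ≤ wNorm x f S := by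
  apply Real.sSup_nonneg
  rintro _ ⟨t, ht, rfl⟩
  exact div_nonneg (abs_nonneg _) (hf t ht).le

lemma le_wNorm13 {x f : ℝ → ℝ} {S : Set ℝ} (hf : ∀ t ∈ S, 0 < f t)
    (hb : BddAbove ((fun t => |x t| / f t) '' S)) {t : ℝ} (ht : t ∈ S) :
    |x t| ≤ wNorm x f S * f t := by
  have := le_csSup hb ⟨t, ht, rfl⟩
  rwa [div_le_iff₀ (hf t ht)] at this

lemma limit13 {f g : ℝ → ℝ} {p : ℕ} {K L : ℝ} {H : ℝ → ℕ → ℝ → ℝ} {φ : ℝ → ℝ} (U : Ultrafilter ℝ)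
    (hU : (U : Filter ℝ) ≤ atTop) (hφ : Tendsto φ atTop (𝓝 L))
    (hH : ∀ᶠ a in atTop, Chain13 p (Icc 0 a) (H a) ∧
      (∀ t ∈ Icc 0 a, |H a 0 t| ≤ φ a * f t) ∧
      (∀ s t, 0 ≤ s → s ≤ t → t ≤ a → |H a p t - H a p s| ≤ ∫ x in s..t, g x) ∧
      ∀ j ≤ p, (∀ t ∈ Icc 0 a, |H a j t| ≤ K) ∧
        (∀ s ∈ Icc 0 a, ∀ t ∈ Icc 0 a, |H a j t - H a j s| ≤ K * |t - s|)) :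
    ∃ Z : ℕ → ℝ → ℝ, (∀ j ≤ p, ∀ t, 0 ≤ t → Tendsto (fun a => H a j t) U (𝓝 (Z j t))) ∧
      Chain13 p (Ici 0) Z ∧ (∀ j ≤ p, ∀ t, 0 ≤ t → |Z j t| ≤ K) ∧
      (∀ t, 0 ≤ t → |Z 0 t| ≤ L * f t) ∧
      ContinuousOn (Z p) (Ici 0) ∧
      (∀ s t, 0 ≤ s → s ≤ t → |Z p t - Z p s| ≤ ∫ x in s..t, g x) := by
  have hUe : ∀ T : ℝ, ∀ᶠ a in (U : Filter ℝ), T ≤ a := fun T => hU (eventually_ge_atTop T)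
  have hHU := hU hH
  have ex : ∀ j t, ∃ z, j ≤ p → 0 ≤ t → Tendsto (fun a => H a j t) U (𝓝 z) := by
    intro j t
    by_cases h : j ≤ p ∧ 0 ≤ t
    · have hmem : ∀ᶠ a in (U : Filter ℝ), H a j t ∈ Icc (-K) K := by
        filter_upwards [hHU, hUe t] with a ha hta
        exact abs_le.1 ((ha.2.2.2 j h.1).1 t ⟨h.2, hta⟩)
      obtain ⟨z, _, hz⟩ := isCompact_Icc.ultrafilter_le_nhds' (U.map (fun a => H a j t)) hmem
      exact ⟨z, fun _ _ => hz⟩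
    · exact ⟨0, fun h1 h2 => absurd ⟨h1, h2⟩ h⟩
  choose Z hZ using ex
  have hlip : ∀ j ≤ p, ∀ s t, 0 ≤ s → 0 ≤ t → |Z j t - Z j s| ≤ K * |t - s| := by
    intro j hj s t hs ht
    refine le_of_tendsto ((hZ j t hj ht).sub (hZ j s hj hs)).abs ?_
    filter_upwards [hHU, hUe s, hUe t] with a ha h1 h2
    exact (ha.2.2.2 j hj).2 s ⟨hs, h1⟩ t ⟨ht, h2⟩
  refine ⟨Z, fun j hj t ht => hZ j t hj ht, ?_, ?_, ?_, ?_, ?_⟩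
  · intro j hj s hs
    have hs : 0 ≤ s := hs
    have tay : ∀ t, 0 ≤ t → |Z j t - Z j s - (t - s) * Z (j + 1) s| ≤ |K| * |t - s| ^ 2 := by
      intro t ht
      refine le_of_tendsto (((hZ j t hj.le ht).sub (hZ j s hj.le hs)).sub
        ((hZ (j + 1) s hj hs).const_mul (t - s))).abs ?_
      filter_upwards [hHU, hUe s, hUe t] with a ha h1 h2
      exact taylor13 (ha.1 j hj) (ha.2.2.2 (j + 1) hj).2 ⟨hs, h1⟩ ⟨ht, h2⟩
    rw [hasDerivWithinAt_iff_isLittleO]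
    have h1 : (fun t => Z j t - Z j s - (t - s) • Z (j + 1) s) =O[𝓝[Ici 0] s]
        (fun t => (t - s) ^ 2) := by
      refine Asymptotics.IsBigO.of_bound |K| ?_
      filter_upwards [self_mem_nhdsWithin] with t ht
      simpa [Real.norm_eq_abs] using tay t ht
    refine h1.trans_isLittleO ?_
    have h2 : (fun t : ℝ => (t - s) ^ 2) =o[𝓝 s] (fun t => t - s) := by
      have h3 : Tendsto (fun t : ℝ => t - s) (𝓝 s) (𝓝 0) := by
        have h4 : Continuous (fun t : ℝ => t - s) := by fun_prop
        simpa using h4.tendsto s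
      have := (Asymptotics.isLittleO_pow_id (𝕜 := ℝ) (one_lt_two)).comp_tendsto h3
      simpa [Function.comp_def] using this
    exact h2.mono nhdsWithin_le_nhds
  · intro j hj t ht
    refine le_of_tendsto (hZ j t hj ht).abs ?_
    filter_upwards [hHU, hUe t] with a ha h1
    exact (ha.2.2.2 j hj).1 t ⟨ht, h1⟩
  · intro t ht
    refine le_of_tendsto_of_tendsto (hZ 0 t (by omega) ht).abs ((hφ.mono_left hU).mul_const (f t)) ?_
    filter_upwards [hHU, hUe t] with a ha h1
    exact ha.2.1 t ⟨ht, h1⟩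
  · have : LipschitzOnWith (Real.toNNReal |K|) (Z p) (Ici 0) := by
      refine LipschitzOnWith.of_dist_le_mul fun x hx y hy => ?_
      rw [Real.dist_eq, Real.dist_eq, Real.coe_toNNReal _ (abs_nonneg _)]
      refine (hlip p le_rfl y x hy hx).trans ?_
      gcongr
      exact le_abs_self _
    exact this.continuousOn
  · intro s t hs hst
    have ht := hs.trans hst
    refine le_of_tendsto ((hZ p t le_rfl ht).sub (hZ p s le_rfl hs)).abs ?_
    filter_upwards [hHU, hUe t] with a ha h1
    exact ha.2.2.1 s t hs hst h1

lemma extremal13 {f g : ℝ → ℝ} {p n : ℕ} {a : ℝ} {G : ℝ → ℝ}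
    (hf_c : ContinuousOn f (Ici 0)) (hf_pos : ∀ t ∈ Ici (0:ℝ), 0 < f t)
    (hg_c : ContinuousOn g (Ici 0)) (hg_pos : ∀ t ∈ Ici (0:ℝ), 0 < g t)
    (hp : 1 ≤ p) (ha0 : 0 < a) (h : IsExtremalSpline f g (p + 1) n a G) :
    Chain13 p (Icc 0 a) (fun j => iteratedDerivWithin j G (Icc 0 a)) ∧
    (∀ t ∈ Icc 0 a, |iteratedDerivWithin 0 G (Icc 0 a) t| ≤ wNorm G f (Icc 0 a) * f t) ∧
    (∀ s t, 0 ≤ s → s ≤ t → t ≤ a → |iteratedDerivWithin p G (Icc 0 a) t -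
      iteratedDerivWithin p G (Icc 0 a) s| ≤ ∫ x in s..t, g x) ∧
    ∀ (X : ℕ → ℝ → ℝ) (k : ℕ), k ≤ p → Chain13 p (Icc 0 a) X →
      (∀ s t, 0 ≤ s → s ≤ t → t ≤ a → |X p t - X p s| ≤ ∫ x in s..t, g x) →
      (∀ t, 0 ≤ t → t ≤ a → |X 0 t| ≤ wNorm G f (Icc 0 a) * f t) →
      |X k 0| ≤ |iteratedDerivWithin k G (Icc 0 a) 0| := by
  obtain ⟨⟨m, hmn, u, ε, hS⟩, b, hb1, hba, hb, hosc⟩ := h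
  have hinc0 := spline_inc13 hg_c ha0 hS
  obtain ⟨hε, h0, ha, hu, hC, hD⟩ := hS
  have hsub : Icc 0 a ⊆ Ici (0 : ℝ) := fun t ht => ht.1
  have hub := u_bounds13 h0 ha hu
  have hchain : Chain13 p (Icc 0 a) (fun j => iteratedDerivWithin j G (Icc 0 a)) :=
    chain_of_contDiffOn13 (uniqueDiffOn_Icc ha0) hC
  have hbdd : BddAbove ((fun t => |G t| / f t) '' Icc 0 a) :=
    (isCompact_Icc.image_of_continuousOn (hC.continuousOn.abs.div (hf_c.mono hsub)
      (fun t ht => (hf_pos t (hsub ht)).ne'))).bddAbove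
  have hle : ∀ t ∈ Icc 0 a, |iteratedDerivWithin 0 G (Icc 0 a) t| ≤ wNorm G f (Icc 0 a) * f t := by
    intro t ht
    rw [iteratedDerivWithin_zero]
    exact le_wNorm13 (fun t ht => hf_pos t (hsub ht)) hbdd ht
  have hinc : ∀ i ≤ m, ∀ s t, u i ≤ s → s < t → t ≤ u (i + 1) →
      |iteratedDerivWithin p G (Icc 0 a) t - iteratedDerivWithin p G (Icc 0 a) s| =
        ∫ x in s..t, g x := by
    intro i hi s t hs hst ht
    have := int_pos13 hg_c hg_pos ((hub i (by omega)).1.trans hs) hst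
    rw [hinc0 i hi s t hs hst ht, abs_mul, abs_mul, abs_pow, abs_neg, abs_one, one_pow, mul_one,
      abs_of_pos this]
    rcases hε with h | h <;> simp [h]
  have hφ : 0 < wNorm G f (Icc 0 a) := by
    refine lt_of_le_of_ne (wNorm_nonneg13 (fun t ht => hf_pos t (hsub ht))) (fun he => ?_)
    have hz : EqOn G (fun _ => 0) (Icc 0 a) := by
      intro t ht
      have := hle t ht
      rw [← he, zero_mul, iteratedDerivWithin_zero] at this
      exact abs_eq_zero.1 (le_antisymm this (abs_nonneg _))
    have h1 := iteratedDerivWithin_congr (n := p) hz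
    have h2 : ∀ x ∈ Icc 0 a, iteratedDerivWithin p G (Icc 0 a) x =
        iteratedDerivWithin p (fun _ => (0 : ℝ)) (Icc 0 a) 0 := by
      intro x hx
      rw [h1 hx]
      simp [iteratedDerivWithin_const]
    have h3 := hu 0 (by omega)
    have h4 := hinc 0 (by omega) (u 0) (u 1) le_rfl h3 le_rfl
    have h5 := int_pos13 hg_c hg_pos (by rw [h0]) h3
    rw [h2 _ (hub 0 (by omega)), h2 _ (hub 1 (by omega)), sub_self, abs_zero] at h4
    simp only [zero_add] at h5
    linarith
  refine ⟨hchain, hle, glue13 hg_c h0 ha hu hinc, fun X k hk hX hXi hXf => ?_⟩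
  exact compare13 (f := f) (g := g) (b := b) (G := fun j => iteratedDerivWithin j G (Icc 0 a))
    hp hk hmn ha0 hφ hf_pos hchain hX h0 ha hu
    (fun s t hs hst => int_pos13 hg_c hg_pos hs hst) hinc hXi hXf hb1 hba hb
    (fun i h1 h2 => by rw [iteratedDerivWithin_zero]; exact hosc i h1 h2)

end Helpers

/-- Theorem 5: if φ_{r,0,f}(∞) < ∞ then for every k = 1, …, r-1,
ω(D^k, φ_{r,n,f}(∞)) = lim_{a→∞} |G_{r,n,f,a}^{(k)}(0)|. -/
theorem statement13
    (f g : ℝ → ℝ)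
    (hf_c : ContinuousOn f (Ici 0)) (hf_pos : ∀ t ∈ Ici (0:ℝ), 0 < f t)
    (hf_anti : AntitoneOn f (Ici 0))
    (hg_c : ContinuousOn g (Ici 0)) (hg_pos : ∀ t ∈ Ici (0:ℝ), 0 < g t)
    (hg_anti : AntitoneOn g (Ici 0))
    (r : ℕ) (hr : 1 ≤ r) (n : ℕ)
    (φ0 : ℝ → ℝ)
    (hφ0 : ∀ a, 0 < a → ∃ G : ℝ → ℝ,
      IsExtremalSpline f g r 0 a G ∧ φ0 a = wNorm G f (Icc 0 a))
    (hfin : ∃ C, ∀ a, 0 < a → φ0 a ≤ C)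
    (Ga : ℝ → ℝ → ℝ) (hGa : ∀ a, 0 < a → IsExtremalSpline f g r n a (Ga a))
    (L : ℝ) (hL : Tendsto (fun a => wNorm (Ga a) f (Icc 0 a)) atTop (nhds L))
    (k : ℕ) (hk1 : 1 ≤ k) (hk2 : k < r) :
    ∃ L' : ℝ,
      Tendsto (fun a => |iteratedDerivWithin k (Ga a) (Icc 0 a) 0|) atTop (nhds L') ∧
      omegaD f g r k L = L' := by
  obtain ⟨p, rfl⟩ : ∃ p, r = p + 1 := ⟨r - 1, by omega⟩
  have hp : 1 ≤ p := by omega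
  have hkp : k ≤ p := by omega
  have hE := fun a (ha : 0 < a) => extremal13 hf_c hf_pos hg_c hg_pos hp ha (hGa a ha)
  have hf0 : 0 < f 0 := hf_pos 0 (mem_Ici.2 le_rfl)
  have hg0 : 0 < g 0 := hg_pos 0 (mem_Ici.2 le_rfl)
  have hL0 : 0 ≤ L := by
    refine ge_of_tendsto hL ?_
    filter_upwards [] with a
    exact wNorm_nonneg13 (fun t ht => hf_pos t ht.1)
  obtain ⟨K, hK⟩ := bound_all13 ((L + 1) * f 0) (g 0) p
  have hH : ∀ᶠ a in atTop, Chain13 p (Icc 0 a) (fun j => iteratedDerivWithin j (Ga a) (Icc 0 a)) ∧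
      (∀ t ∈ Icc 0 a, |iteratedDerivWithin 0 (Ga a) (Icc 0 a) t| ≤
        wNorm (Ga a) f (Icc 0 a) * f t) ∧
      (∀ s t, 0 ≤ s → s ≤ t → t ≤ a → |iteratedDerivWithin p (Ga a) (Icc 0 a) t -
        iteratedDerivWithin p (Ga a) (Icc 0 a) s| ≤ ∫ x in s..t, g x) ∧
      ∀ j ≤ p, (∀ t ∈ Icc 0 a, |iteratedDerivWithin j (Ga a) (Icc 0 a) t| ≤ K) ∧
        (∀ s ∈ Icc 0 a, ∀ t ∈ Icc 0 a, |iteratedDerivWithin j (Ga a) (Icc 0 a) t -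
          iteratedDerivWithin j (Ga a) (Icc 0 a) s| ≤ K * |t - s|) := by
    filter_upwards [eventually_ge_atTop 1, hL.eventually_le_const (show L < L + 1 by linarith)]
      with a ha hφ
    obtain ⟨e1, e2, e3, -⟩ := hE a (by linarith)
    refine ⟨e1, e2, e3, hK (fun j => iteratedDerivWithin j (Ga a) (Icc 0 a)) a ha e1 ?_ ?_⟩
    · intro t ht
      refine (e2 t ht).trans ?_
      have h1 : f t ≤ f 0 := hf_anti (mem_Ici.2 le_rfl) ht.1 ht.1
      have h2 : 0 < f t := hf_pos t ht.1
      have h3 : 0 ≤ L + 1 := by linarith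
      gcongr
    · have main : ∀ s t, 0 ≤ s → s ≤ t → t ≤ a → |iteratedDerivWithin p (Ga a) (Icc 0 a) t -
          iteratedDerivWithin p (Ga a) (Icc 0 a) s| ≤ g 0 * |t - s| := by
        intro s t hs hst ht
        rw [abs_of_nonneg (show 0 ≤ t - s by linarith)]
        exact (e3 s t hs hst ht).trans (int_le13 hg_c hg_anti hs hst le_rfl hs)
      intro s hs t ht
      rcases le_total s t with h | h
      · exact main s t hs.1 h ht.2
      · rw [abs_sub_comm, abs_sub_comm t s]
        exact main t s ht.1 h hs.2
  -- upper estimate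
  have upper : ∀ (U : Ultrafilter ℝ) (ℓ : ℝ), (U : Filter ℝ) ≤ atTop →
      Tendsto (fun a => |iteratedDerivWithin k (Ga a) (Icc 0 a) 0|) U (𝓝 ℓ) →
      ∀ x, MemW f g (p + 1) x → wNorm x f (Ici 0) ≤ L →
      ∀ t, 0 ≤ t → |iteratedDerivWithin k x (Ici 0) t| ≤ ℓ := by
    intro U ℓ hU hℓ x hx hxL t ht
    obtain ⟨-, hx2, hx3, hx4⟩ := hx
    rw [Nat.add_sub_cancel] at hx2 hx4
    have hxc : Chain13 p (Ici 0) (fun j => iteratedDerivWithin j x (Ici 0)) :=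
      chain_of_contDiffOn13 (uniqueDiffOn_Ici 0) hx2
    have hxf : ∀ s, 0 ≤ s → |x s| ≤ L * f s := fun s hs =>
      (le_wNorm13 hf_pos hx3 hs).trans (by gcongr; exact (hf_pos s hs).le)
    have cmp : ∀ a c, 0 < a → 0 ≤ c → c ≤ 1 → c * L ≤ wNorm (Ga a) f (Icc 0 a) →
        c * |iteratedDerivWithin k x (Ici 0) t| ≤ |iteratedDerivWithin k (Ga a) (Icc 0 a) 0| := by
      intro a c ha hc0 hc1 hcL
      have := (hE a ha).2.2.2 (fun j s => c * iteratedDerivWithin j x (Ici 0) (s + t)) k hkp ?_ ?_ ?_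
      · simpa [abs_mul, abs_of_nonneg hc0] using this
      · intro j hj s hs
        have h1 := hxc j hj (s + t) (add_nonneg hs.1 ht)
        have h2 : HasDerivWithinAt (fun s : ℝ => s + t) 1 (Icc 0 a) s :=
          (hasDerivWithinAt_id s _).add_const t
        have h3 := h1.scomp s h2 (fun y hy => add_nonneg hy.1 ht)
        simpa [Function.comp_def] using h3.const_mul c
      · intro s s' hs hss hsa
        have h1 := hx4 (s + t) (s' + t) (by linarith) (by linarith)
        have h2 : ∫ u in (s + t)..(s' + t), g u ≤ ∫ u in s..s', g u := by
          rw [← intervalIntegral.integral_comp_add_right (fun u => g u) t]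
          refine intervalIntegral.integral_mono_on hss ?_ ?_ ?_
          · refine ContinuousOn.intervalIntegrable_of_Icc hss ?_
            exact hg_c.comp (by fun_prop) (fun y hy => add_nonneg (hs.trans hy.1) ht)
          · exact ContinuousOn.intervalIntegrable_of_Icc hss
              (hg_c.mono fun y hy => hs.trans hy.1)
          · intro y hy
            have hy0 := hs.trans hy.1
            exact hg_anti hy0 (add_nonneg hy0 ht) (by linarith)
        rw [← mul_sub, abs_mul, abs_of_nonneg hc0]
        refine (mul_le_of_le_one_left (abs_nonneg _) hc1).trans (h1.trans h2)
      · intro s hs hsa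
        rw [iteratedDerivWithin_zero, abs_mul, abs_of_nonneg hc0]
        have h1 := hxf (s + t) (by linarith)
        have h2 : f (s + t) ≤ f s := hf_anti hs (add_nonneg hs ht) (by linarith)
        have h3 := hf_pos s hs
        calc c * |x (s + t)| ≤ c * (L * f s) := by gcongr; exact h1.trans (by gcongr)
          _ = (c * L) * f s := by ring
          _ ≤ _ := by gcongr
    rcases hL0.eq_or_lt with h | h
    · refine ge_of_tendsto hℓ ?_
      filter_upwards [hU (eventually_gt_atTop 0)] with a ha
      have := cmp a 1 ha zero_le_one le_rfl (by
        rw [← h, mul_zero]; exact wNorm_nonneg13 (fun t ht => hf_pos t ht.1))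
      simpa using this
    · have hlim : Tendsto (fun a => min 1 (wNorm (Ga a) f (Icc 0 a) / L) *
          |iteratedDerivWithin k x (Ici 0) t|) U
          (𝓝 (min 1 (L / L) * |iteratedDerivWithin k x (Ici 0) t|)) :=
        (tendsto_const_nhds.min ((hL.mono_left hU).div_const L)).mul_const _
      rw [div_self h.ne', min_self, one_mul] at hlim
      refine le_of_tendsto_of_tendsto hlim hℓ ?_
      filter_upwards [hU (eventually_gt_atTop 0)] with a ha
      refine cmp a _ ha (le_min zero_le_one (div_nonneg
        (wNorm_nonneg13 (fun t ht => hf_pos t ht.1)) h.le)) (min_le_left _ _) ?_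
      calc _ ≤ (wNorm (Ga a) f (Icc 0 a) / L) * L := by gcongr; exact min_le_right _ _
        _ = _ := div_mul_cancel₀ _ h.ne'
  -- main
  refine ⟨omegaD f g (p + 1) k L, ?_, rfl⟩
  rw [Filter.tendsto_iff_ultrafilter]
  intro U hU
  obtain ⟨Z, hZ1, hZ2, hZ3, hZ4, hZ5, hZ6⟩ := limit13 U hU hL hH
  have hZl := (hZ1 k hkp 0 le_rfl).abs
  have hZE := chain_eqOn13 (uniqueDiffOn_Ici (0 : ℝ)) hZ2
  have hZC := contDiffOn_of_chain13 (uniqueDiffOn_Ici (0 : ℝ)) hZ2 hZ5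
  have hZbd : ∀ y ∈ (fun t => |Z 0 t| / f t) '' Ici 0, y ≤ L := by
    rintro _ ⟨t, ht, rfl⟩
    exact (div_le_iff₀ (hf_pos t ht)).2 (hZ4 t ht)
  have hZW : MemW f g (p + 1) (Z 0) := by
    refine ⟨hZC.continuousOn, hZC, ⟨L, hZbd⟩, fun s t hs hst => ?_⟩
    rw [Nat.add_sub_cancel, hZE p le_rfl (show t ∈ Ici 0 from hs.trans hst),
      hZE p le_rfl (show s ∈ Ici 0 from hs)]
    exact hZ6 s t hs hst
  have hZn : wNorm (Z 0) f (Ici 0) ≤ L := Real.sSup_le hZbd hL0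
  have hval : omegaD f g (p + 1) k L = |Z k 0| := by
    have hub : ∀ y ∈ {y | ∃ x : ℝ → ℝ, MemW f g (p + 1) x ∧ wNorm x f (Ici 0) ≤ L ∧
        y = supNorm (iteratedDerivWithin k x (Ici 0)) (Ici 0)}, y ≤ |Z k 0| := by
      rintro _ ⟨x, hx, hxL, rfl⟩
      refine Real.sSup_le ?_ (abs_nonneg _)
      rintro _ ⟨t, ht, rfl⟩
      exact upper U _ hU hZl x hx hxL t ht
    refine le_antisymm (Real.sSup_le hub (abs_nonneg _)) ?_
    refine le_trans ?_ (le_csSup ⟨_, hub⟩ ⟨Z 0, hZW, hZn, rfl⟩)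
    refine le_csSup ⟨|Z k 0|, ?_⟩ ⟨0, mem_Ici.2 le_rfl, ?_⟩
    · rintro _ ⟨t, ht, rfl⟩
      exact upper U _ hU hZl _ hZW hZn t ht
    · simp only [hZE k hkp (mem_Ici.2 (le_refl (0 : ℝ)))]
  rw [hval]
  exact hZl
end

section
/- Let g be a continuous, positive, non-increasing function on [0,∞) and let r ∈ ℕ. Assume conditions (6) hold, i.e., A_0, …, A_{r−1} are finite. Let Q be a bounded perfect g-spline of order r on [0,∞) with n ∈ ℤ₊ knots 0 < t_1 < ⋯ < t_n (i.e., Q ∈ C^{r−1}[0,∞), Q is bounded, and with t_0 := 0, on each interval (t_i, t_{i+1}) (and on (t_n, ∞)) Q is r times differentiable with Q^{(r)}(t) = ε·(−1)^i g(t) for a fixed ε' ∈ {1,−1}). Then there exists ε ∈ {1,−1} such that Q^{(s)}(t) = ε·P_r^{(s)}(t) for all t ≥ t_n and all s = 1, 2, …, r. -/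
open Set Filter MeasureTheory
open scoped Topology

lemma poly_antideriv (p : Polynomial ℝ) : ∃ q : Polynomial ℝ, q.derivative = p := by
  induction p using Polynomial.induction_on' with
  | add p q hp hq =>
    obtain ⟨a, ha⟩ := hp
    obtain ⟨b, hb⟩ := hq
    exact ⟨a + b, by simp [ha, hb]⟩
  | monomial n a =>
    refine ⟨Polynomial.monomial (n + 1) (a / (n + 1)), ?_⟩
    rw [Polynomial.derivative_monomial]
    have : (n : ℝ) + 1 ≠ 0 := by positivity
    push_cast
    try simp only [Nat.add_sub_cancel]
    congr 1
    field_simp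

lemma const_of_hasDerivWithin_zero (a : ℝ) (f : ℝ → ℝ)
    (h : ∀ t ∈ Ioi a, HasDerivWithinAt f 0 (Ioi a) t) :
    ∃ c, ∀ t ∈ Ioi a, f t = c := by
  refine ⟨f (a + 1), fun t ht => ?_⟩
  have := (convex_Ioi a).norm_image_sub_le_of_norm_hasDerivWithin_le (C := 0) (f' := fun _ => 0) h
    (by simp) (show a + 1 ∈ Ioi a by simp) ht
  simp only [zero_mul, norm_le_zero_iff] at this
  linarith

lemma poly_of_iter_zero (a : ℝ) (m : ℕ) : ∀ f : ℝ → ℝ, ContDiffOn ℝ (m : ℕ) f (Ioi a) →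
    (∀ t ∈ Ioi a, iteratedDerivWithin m f (Ioi a) t = 0) →
    ∃ p : Polynomial ℝ, ∀ t ∈ Ioi a, f t = p.eval t := by
  induction m with
  | zero =>
    intro f _ h
    exact ⟨0, fun t ht => by simpa using h t ht⟩
  | succ m ih =>
    intro f hf h
    have hu : UniqueDiffOn ℝ (Ioi a) := isOpen_Ioi.uniqueDiffOn
    push_cast at hf
    obtain ⟨hd, -, hc⟩ := (contDiffOn_succ_iff_derivWithin hu).1 hf
    obtain ⟨p, hp⟩ := ih (derivWithin f (Ioi a)) hc (fun t ht => by
      rw [← iteratedDerivWithin_succ']; exact h t ht)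
    obtain ⟨q, hq⟩ := poly_antideriv p
    obtain ⟨c, hc⟩ := const_of_hasDerivWithin_zero a (fun t => f t - q.eval t) (fun t ht => by
      have h1 := (hd t ht).hasDerivWithinAt
      have h2 := (q.hasDerivAt t).hasDerivWithinAt (s := Ioi a)
      have h3 := h1.sub h2
      rw [hp t ht, hq, sub_self] at h3
      exact h3)
    exact ⟨q + Polynomial.C c, fun t ht => by
      have := hc t ht
      simp only [Polynomial.eval_add, Polynomial.eval_C]
      linarith⟩

lemma hasDeriv_int (f : ℝ → ℝ) (hf : ContinuousOn f (Ici 0)) (t : ℝ) (ht : t ∈ Ici (0:ℝ)) :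
    HasDerivWithinAt (fun t => ∫ s in (0:ℝ)..t, f s) (f t) (Ici 0) t := by
  have hc : Continuous (fun x : ℝ => f (max x 0)) :=
    hf.comp_continuous (by fun_prop) (fun x => by simp)
  have h := (hc.integral_hasStrictDerivAt 0 t).hasDerivAt.hasDerivWithinAt (s := Ici 0)
  have ht' : max t 0 = t := max_eq_left ht
  simp only [ht'] at h
  have key : ∀ x ∈ Ici (0:ℝ), ∫ s in (0:ℝ)..x, f s = ∫ s in (0:ℝ)..x, f (max s 0) := by
    intro x hx
    apply intervalIntegral.integral_congr
    intro s hs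
    rw [uIcc_of_le hx] at hs
    simp [max_eq_left hs.1]
  exact h.congr key (key t ht)

lemma gk_cont (g : ℝ → ℝ) (hg : ContinuousOn g (Ici 0)) (k : ℕ) :
    ContinuousOn (gk g k) (Ici 0) := by
  induction k with
  | zero => exact hg
  | succ k ih => exact fun t ht => (hasDeriv_int _ ih t ht).continuousWithinAt

lemma Pfun_zero (g : ℝ → ℝ) : Pfun g 0 = g := by
  funext t; simp [Pfun, gk]

lemma Pfun_succ (g : ℝ → ℝ) (k : ℕ) : Pfun g (k + 1) = fun t =>
    (∑ s : Fin k, (-1 : ℝ) ^ (k - 1 - s.1 + 1) * Acoef g s.1 * t ^ (k - 1 - s.1 + 1) /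
      (Nat.factorial (k - 1 - s.1 + 1) : ℝ)) + Acoef g k + (-1 : ℝ) ^ (k + 1) * gk g (k + 1) t := by
  funext t
  unfold Pfun
  rw [Fin.sum_univ_castSucc]
  congr 1
  congr 1
  · apply Finset.sum_congr rfl
    intro s _
    have : k + 1 - 1 - s.castSucc.1 = k - 1 - s.1 + 1 := by
      have := s.2
      simp only [Fin.val_castSucc]
      omega
    rw [this]
    simp
  · simp

lemma Pfun_succ_zero (g : ℝ → ℝ) (k : ℕ) : Pfun g (k + 1) 0 = Acoef g k := by
  rw [Pfun_succ]; simp [gk]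

lemma Acoef_eq (g : ℝ → ℝ) (k : ℕ) : Acoef g k = ∫ t in Ioi (0:ℝ), Pfun g k t := by
  cases k with
  | zero => rw [Pfun_zero, Acoef]
  | succ k => rw [Acoef]; rfl

lemma Pfun_deriv (g : ℝ → ℝ) (hg : ContinuousOn g (Ici 0)) (k : ℕ) (t : ℝ)
    (ht : t ∈ Ici (0:ℝ)) :
    HasDerivWithinAt (Pfun g (k + 1)) (-(Pfun g k t)) (Ici 0) t := by
  rw [Pfun_succ]
  have h1 : HasDerivWithinAt (fun t : ℝ => ∑ s : Fin k, (-1 : ℝ) ^ (k - 1 - s.1 + 1) * Acoef g s.1 *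
      t ^ (k - 1 - s.1 + 1) / (Nat.factorial (k - 1 - s.1 + 1) : ℝ))
      (∑ s : Fin k, -((-1 : ℝ) ^ (k - 1 - s.1) * Acoef g s.1 * t ^ (k - 1 - s.1) /
    (Nat.factorial (k - 1 - s.1) : ℝ))) (Ici 0) t := by
    apply HasDerivWithinAt.fun_sum
    intro s _
    generalize k - 1 - s.1 = m
    have h := (((hasDerivAt_pow (m + 1) t).const_mul ((-1 : ℝ) ^ (m + 1) * Acoef g s.1)).div_const
      (Nat.factorial (m + 1) : ℝ)).hasDerivWithinAt (s := Ici 0)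
    refine HasDerivWithinAt.congr_deriv h ?_
    have : (m : ℝ) + 1 ≠ 0 := by positivity
    have : (Nat.factorial m : ℝ) ≠ 0 := by positivity
    rw [Nat.factorial_succ]
    push_cast
    try simp only [Nat.add_sub_cancel]
    field_simp
    ring
  have h2 : HasDerivWithinAt (gk g (k + 1)) (gk g k t) (Ici 0) t :=
    hasDeriv_int _ (gk_cont g hg k) t ht
  have h3 := (h1.add_const (Acoef g k)).add (h2.const_mul ((-1 : ℝ) ^ (k + 1)))
  refine HasDerivWithinAt.congr_deriv h3 ?_
  simp only [Pfun, Finset.sum_neg_distrib]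
  ring

lemma Pfun_smooth (g : ℝ → ℝ) (hg : ContinuousOn g (Ici 0)) (k : ℕ) :
    ContDiffOn ℝ (k : ℕ) (Pfun g k) (Ici 0) ∧
    ∀ t ∈ Ici (0:ℝ), iteratedDerivWithin k (Pfun g k) (Ici 0) t = (-1 : ℝ) ^ k * g t := by
  have hu : UniqueDiffOn ℝ (Ici (0:ℝ)) := uniqueDiffOn_Ici 0
  induction k with
  | zero =>
    rw [Pfun_zero]
    exact ⟨by simpa using hg, by simp⟩
  | succ k ih =>
    have hd : EqOn (derivWithin (Pfun g (k + 1)) (Ici 0)) (fun t => -(Pfun g k t)) (Ici 0) :=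
      fun t ht => (Pfun_deriv g hg k t ht).derivWithin (hu t ht)
    constructor
    · push_cast
      rw [contDiffOn_succ_iff_derivWithin hu]
      refine ⟨fun t ht => (Pfun_deriv g hg k t ht).differentiableWithinAt, by simp, ?_⟩
      exact ih.1.neg.congr hd
    · intro t ht
      rw [iteratedDerivWithin_succ', iteratedDerivWithin_congr hd ht]
      have : iteratedDerivWithin k (fun t => -(Pfun g k t)) (Ici 0) t
          = -iteratedDerivWithin k (Pfun g k) (Ici 0) t := by
        have := iteratedDerivWithin_const_mul_field (n := k) (s := Ici (0:ℝ)) (x := t) (-1 : ℝ) (Pfun g k)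
        simpa using this
      rw [this, ih.2 t ht]
      ring

lemma Pfun_tendsto (g : ℝ → ℝ) (hg : ContinuousOn g (Ici 0)) (k : ℕ)
    (hi : IntegrableOn (Pfun g k) (Ioi 0)) :
    Tendsto (Pfun g (k + 1)) atTop (𝓝 0) := by
  have h := intervalIntegral_tendsto_integral_Ioi 0 hi tendsto_id
  rw [← Acoef_eq] at h
  have h' := h.const_sub (Acoef g k)
  rw [sub_self] at h'
  refine h'.congr' ?_
  filter_upwards [eventually_ge_atTop (0:ℝ)] with t ht
  have hc : ContinuousOn (Pfun g k) (Ici 0) := (Pfun_smooth g hg k).1.continuousOn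
  have h1 := intervalIntegral.integral_eq_sub_of_hasDeriv_right_of_le ht
    (f := Pfun g (k + 1)) (f' := fun t => -(Pfun g k t))
    ((Pfun_smooth g hg (k+1)).1.continuousOn.mono Icc_subset_Ici_self)
    (fun x hx => (Pfun_deriv g hg k x hx.1.le).mono (fun y hy => le_trans hx.1.le (le_of_lt hy)))
    (by
      apply ContinuousOn.intervalIntegrable
      rw [uIcc_of_le ht]
      exact (hc.mono Icc_subset_Ici_self).neg)
  rw [intervalIntegral.integral_neg, Pfun_succ_zero] at h1
  simp only [id]
  linarith

lemma iter_subset (f : ℝ → ℝ) (m : ℕ) (s t : Set ℝ) (st : s ⊆ t) (hs : UniqueDiffOn ℝ s)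
    (ht : UniqueDiffOn ℝ t) (h : ContDiffOn ℝ (m : ℕ) f t) (x : ℝ) (hx : x ∈ s) :
    iteratedDerivWithin m f s x = iteratedDerivWithin m f t x := by
  simp only [iteratedDerivWithin, iteratedFDerivWithin_subset st hs ht h hx]

/-- Lemma 5: a bounded perfect g-spline Q of order r on [0,∞) with n knots
agrees (up to a sign ε ∈ {1,-1}) with P_r in all derivatives of order s = 1, …, r
beyond its last knot. -/
theorem statement14
    (g : ℝ → ℝ)
    (hg_c : ContinuousOn g (Ici 0)) (hg_pos : ∀ t ∈ Ici (0:ℝ), 0 < g t)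
    (hg_anti : AntitoneOn g (Ici 0))
    (r : ℕ) (hr : 1 ≤ r) (h6 : Cond6 g r)
    (n : ℕ) (u : ℕ → ℝ) (ε : ℝ) (Q : ℝ → ℝ)
    (hQ : PerfectSplineInf g r n u ε Q)
    (hbdd : ∃ C, ∀ t ∈ Ici (0:ℝ), |Q t| ≤ C) :
    ∃ ε' : ℝ, (ε' = 1 ∨ ε' = -1) ∧ ∀ s, 1 ≤ s → s ≤ r → ∀ t, u n ≤ t →
      iteratedDerivWithin s Q (Ici (u n)) t =
        ε' * iteratedDerivWithin s (Pfun g r) (Ici 0) t := by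
  obtain ⟨hε, hu0, hmono, hQc, -, hQr, hQd⟩ := hQ
  obtain ⟨C, hC⟩ := hbdd
  have hun : ∀ i ≤ n, 0 ≤ u i := by
    intro i
    induction i with
    | zero => intro _; exact hu0.ge
    | succ i ih => intro hi; exact (ih (by omega)).trans (hmono i (by omega)).le
  have ha : 0 ≤ u n := hun n le_rfl
  set a := u n with hadef
  obtain ⟨k, rfl⟩ : ∃ k, r = k + 1 := ⟨r - 1, by omega⟩
  obtain ⟨hPs, hPd⟩ := Pfun_smooth g hg_c (k + 1)
  have hPt : Tendsto (Pfun g (k + 1)) atTop (𝓝 0) := by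
    apply Pfun_tendsto g hg_c k
    rcases Nat.eq_zero_or_pos k with rfl | hk
    · rw [Pfun_zero]; exact h6.1
    · exact h6.2 k hk (by omega)
  set e : ℝ := ε * (-1) ^ n * (-1) ^ (k + 1) with he
  have hsgn : ∀ m : ℕ, ((-1 : ℝ) ^ m = 1 ∨ (-1 : ℝ) ^ m = -1) := neg_one_pow_eq_or ℝ
  have he1 : e = 1 ∨ e = -1 := by
    rcases hε with h | h <;> rcases hsgn n with h' | h' <;> rcases hsgn (k + 1) with h'' | h'' <;>
      simp [he, h, h', h'']
  refine ⟨e, he1, ?_⟩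
  have hsub : Ioi a ⊆ Ici (0:ℝ) := fun x hx => ha.trans (le_of_lt hx)
  have hsub' : Ici a ⊆ Ici (0:ℝ) := Ici_subset_Ici.2 ha
  have huI : UniqueDiffOn ℝ (Ioi a) := isOpen_Ioi.uniqueDiffOn
  have hPI := hPs.mono hsub
  have heP : ContDiffOn ℝ (k + 1 : ℕ) (fun t => e * Pfun g (k + 1) t) (Ioi a) :=
    contDiffOn_const.mul hPI
  obtain ⟨p, hp⟩ := poly_of_iter_zero a (k + 1) (Q - fun t => e * Pfun g (k + 1) t)
    (hQr.sub heP) (fun t ht => by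
      rw [iteratedDerivWithin_sub ht huI (hQr t ht) (heP t ht),
        iteratedDerivWithin_const_mul_field, hQd t ht,
        iter_subset _ _ _ _ hsub huI (uniqueDiffOn_Ici 0) hPs t ht, hPd t (hsub ht), he]
      have : ((-1 : ℝ) ^ (k + 1)) * (-1) ^ (k + 1) = 1 := by
        rw [← mul_pow]; simp
      linear_combination (-ε * (-1) ^ n * g t) * this)
  have hdeg : p.degree ≤ 0 := by
    rw [← Polynomial.isBoundedUnder_abs_atTop_iff]
    refine ⟨C + 1, ?_⟩
    rw [eventually_map]
    have hP1 : ∀ᶠ t in atTop, |Pfun g (k + 1) t| < 1 := by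
      have := hPt.abs
      rw [abs_zero] at this
      exact this.eventually (gt_mem_nhds one_pos)
    filter_upwards [hP1, eventually_gt_atTop a] with t h1 h2
    rw [← hp t h2]
    have h3 := hC t (hsub h2)
    have h4 : |e * Pfun g (k + 1) t| = |Pfun g (k + 1) t| := by
      rcases he1 with h | h <;> simp [h]
    calc |Q t - e * Pfun g (k + 1) t| ≤ |Q t| + |e * Pfun g (k + 1) t| := abs_sub _ _
      _ ≤ C + 1 := by rw [h4]; linarith
  rw [Polynomial.eq_C_of_degree_le_zero hdeg] at hp
  set c := p.coeff 0
  have hE : EqOn Q (fun t => c + e * Pfun g (k + 1) t) (Ioi a) := by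
    intro t ht
    have := hp t ht
    simp only [Pi.sub_apply, Polynomial.eval_C] at this
    simp only
    linarith
  have hE' : EqOn Q (fun t => c + e * Pfun g (k + 1) t) (Ici a) := by
    refine hE.of_subset_closure (hQc.continuousOn.mono hsub') ?_ Ioi_subset_Ici_self ?_
    · exact continuousOn_const.add (continuousOn_const.mul (hPs.continuousOn.mono hsub'))
    · rw [closure_Ioi]
  intro s hs1 hs2 t ht
  rw [iteratedDerivWithin_congr hE' ht, iteratedDerivWithin_const_add (by omega),
    iteratedDerivWithin_const_mul_field,
    iter_subset _ _ _ _ hsub' (uniqueDiffOn_Ici a) (uniqueDiffOn_Ici 0)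
      (hPs.of_le (by exact_mod_cast hs2)) t ht]
end
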